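/- Suppose d is a differential on A with d(x1) = x2*x3, d(x2) = 0, and d(x3) = 0. Then for every n ≥ 0: ker d ∩ A_n = (range d ∩ A_n) + span_k{ x3^{n−j} * x2^j : 0 ≤ j ≤ n }, and span_k{ x3^{n−j} * x2^j : 0 ≤ j ≤ n } ∩ range d = 0. (Equivalently, the cohomology algebra H(A, d) is isomorphic to k⟨⌈x2⌉, ⌈x3⌉⟩/(⌈x2⌉·⌈x3⌉).) -/

import Mathlib

noncomputable section

/-- `V`, the `k`-linear span of the generators `x1, x2, x3` in the free algebra
`A = k⟨x1,x2,x3⟩`; the `m`-th graded piece of `A` is `A_m = V^m`. -/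
def Vgen (k : Type*) [Field k] : Submodule k (FreeAlgebra k (Fin 3)) :=
  Submodule.span k {FreeAlgebra.ι k 0, FreeAlgebra.ι k 1, FreeAlgebra.ι k 2}

/-- A differential on `A = k⟨x1,x2,x3⟩` (making `A` a connected cochain DG algebra with
generators in degree `1`): a `k`-linear map `d : A → A` with `d(A_m) ⊆ A_{m+1}`, the graded
Leibniz rule, and `d ∘ d = 0`. -/
def IsDGDifferential (k : Type*) [Field k]
    (d : FreeAlgebra k (Fin 3) →ₗ[k] FreeAlgebra k (Fin 3)) : Prop :=
  (∀ m : ℕ, ∀ a ∈ (Vgen k) ^ m, d a ∈ (Vgen k) ^ (m + 1)) ∧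
  (∀ m : ℕ, ∀ a ∈ (Vgen k) ^ m, ∀ b : FreeAlgebra k (Fin 3),
    d (a * b) = d a * b + ((-1 : k) ^ m) • (a * d b)) ∧
  (∀ a : FreeAlgebra k (Fin 3), d (d a) = 0)

namespace FreeAlgebra

/-- A submodule of a free algebra which contains `1` and is stable under left multiplication by
the generators is everything. -/
theorem mem_of_one_mem_of_ι_mul_mem {k X : Type*} [CommSemiring k]
    (S : Submodule k (FreeAlgebra k X)) (one : 1 ∈ S) (mul : ∀ i, ∀ x ∈ S, ι k i * x ∈ S)
    (x : FreeAlgebra k X) : x ∈ S := by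
  suffices h : ∀ s ∈ S, x * s ∈ S by simpa using h 1 one
  induction x using FreeAlgebra.induction with
  | grade0 r => intro s hs; rw [← Algebra.smul_def]; exact S.smul_mem r hs
  | grade1 i => exact mul i
  | mul a b ha hb => intro s hs; rw [mul_assoc]; exact ha _ (hb s hs)
  | add a b ha hb => intro s hs; rw [add_mul]; exact S.add_mem (ha s hs) (hb s hs)

end FreeAlgebra

namespace DGFree

open FreeAlgebra

variable (k : Type*) [Field k]

local notation "A" => FreeAlgebra k (Fin 3)

/-- Left multiplication by the `i`-th generator. -/
abbrev mulGen (i : Fin 3) : A →ₗ[k] A := LinearMap.mulLeft k (ι k i)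

/-- The effect of left multiplication by a generator on a tuple `(u, h u, h (x2 u))`, where `h` is
the contracting homotopy replacing the leftmost `x2 x3` by `± x1` in words with no earlier `x1`. -/
def homotopyStep : Fin 3 → Module.End k (A × A × A) :=
  ![(mulGen k 0 ∘ₗ LinearMap.fst k A (A × A)).prod 0,
    (mulGen k 1 ∘ₗ LinearMap.fst k A (A × A)).prod
      ((LinearMap.snd k A A ∘ₗ LinearMap.snd k A (A × A)).prod
        (-(mulGen k 1 ∘ₗ LinearMap.snd k A A ∘ₗ LinearMap.snd k A (A × A)))),
    (mulGen k 2 ∘ₗ LinearMap.fst k A (A × A)).prod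
      ((-(mulGen k 2 ∘ₗ LinearMap.fst k A A ∘ₗ LinearMap.snd k A (A × A))).prod
        (mulGen k 0 ∘ₗ LinearMap.fst k A (A × A)))]

/-- The tuple `(u, h u, h (x2 u))` as a linear function of `u`. -/
def homotopyTuple : A →ₗ[k] A × A × A :=
  LinearMap.applyₗ (1, 0, 0) ∘ₗ (lift k (homotopyStep k)).toLinearMap

/-- The contracting homotopy. -/
def homotopy : A →ₗ[k] A :=
  LinearMap.fst k A A ∘ₗ LinearMap.snd k A (A × A) ∘ₗ homotopyTuple k

/-- The map `u ↦ homotopy (x2 u)`. -/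
def homotopyAfter : A →ₗ[k] A :=
  LinearMap.snd k A A ∘ₗ LinearMap.snd k A (A × A) ∘ₗ homotopyTuple k

/-- The effect of left multiplication by a generator on a pair `(p u, p (x2 u))`, where `p` is the
projection onto the span of the words `x3 ^ i * x2 ^ j`. -/
def projStep : Fin 3 → Module.End k (A × A) :=
  ![0,
    (LinearMap.snd k A A).prod (mulGen k 1 ∘ₗ LinearMap.snd k A A),
    (mulGen k 2 ∘ₗ LinearMap.fst k A A).prod 0]

/-- The pair `(p u, p (x2 u))` as a linear function of `u`. -/
def projTuple : A →ₗ[k] A × A :=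
  LinearMap.applyₗ (1, ι k 1) ∘ₗ (lift k (projStep k)).toLinearMap

/-- The projection onto the span of the words `x3 ^ i * x2 ^ j`, killing all other words. -/
def proj : A →ₗ[k] A := LinearMap.fst k A A ∘ₗ projTuple k

/-- The map `u ↦ proj (x2 u)`. -/
def projAfter : A →ₗ[k] A := LinearMap.snd k A A ∘ₗ projTuple k

/-- The span of the words `x3 ^ (n - j) * x2 ^ j` of length `n`. -/
abbrev normalSpan (n : ℕ) : Submodule k A :=
  Submodule.span k {p : A | ∃ j ≤ n, p = ι k 2 ^ (n - j) * ι k 1 ^ j}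

variable {k}

theorem homotopyTuple_ι_mul (i : Fin 3) (x : A) :
    homotopyTuple k (ι k i * x) = homotopyStep k i (homotopyTuple k x) := by
  simp [homotopyTuple]

theorem homotopyTuple_fst (x : A) : (homotopyTuple k x).1 = x := by
  refine mem_of_one_mem_of_ι_mul_mem
    (LinearMap.eqLocus (LinearMap.fst k A (A × A) ∘ₗ homotopyTuple k) LinearMap.id) ?_ ?_ x
  · simp [homotopyTuple]
  · intro i x hx
    have hx' : (homotopyTuple k x).1 = x := hx
    change (homotopyTuple k (ι k i * x)).1 = ι k i * x
    rw [homotopyTuple_ι_mul]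
    fin_cases i <;> simp [homotopyStep, hx']

theorem projTuple_ι_mul (i : Fin 3) (x : A) :
    projTuple k (ι k i * x) = projStep k i (projTuple k x) := by
  simp [projTuple]

@[simp] theorem homotopy_one : homotopy k 1 = 0 := by simp [homotopy, homotopyTuple]

@[simp] theorem homotopyAfter_one : homotopyAfter k 1 = 0 := by
  simp [homotopyAfter, homotopyTuple]

@[simp] theorem homotopy_x1_mul (x : A) : homotopy k (ι k 0 * x) = 0 := by
  simp [homotopy, homotopyTuple_ι_mul, homotopyStep]

@[simp] theorem homotopy_x2_mul (x : A) : homotopy k (ι k 1 * x) = homotopyAfter k x := by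
  simp [homotopy, homotopyAfter, homotopyTuple_ι_mul, homotopyStep]

@[simp] theorem homotopy_x3_mul (x : A) :
    homotopy k (ι k 2 * x) = -(ι k 2 * homotopy k x) := by
  simp [homotopy, homotopyTuple_ι_mul, homotopyStep]

@[simp] theorem homotopyAfter_x1_mul (x : A) : homotopyAfter k (ι k 0 * x) = 0 := by
  simp [homotopyAfter, homotopyTuple_ι_mul, homotopyStep]

@[simp] theorem homotopyAfter_x2_mul (x : A) :
    homotopyAfter k (ι k 1 * x) = -(ι k 1 * homotopyAfter k x) := by
  simp [homotopyAfter, homotopyTuple_ι_mul, homotopyStep]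

@[simp] theorem homotopyAfter_x3_mul (x : A) : homotopyAfter k (ι k 2 * x) = ι k 0 * x := by
  simp [homotopyAfter, homotopyTuple_ι_mul, homotopyStep, homotopyTuple_fst]

@[simp] theorem proj_one : proj k 1 = 1 := by simp [proj, projTuple]

@[simp] theorem projAfter_one : projAfter k 1 = ι k 1 := by simp [projAfter, projTuple]

@[simp] theorem proj_x1_mul (x : A) : proj k (ι k 0 * x) = 0 := by
  simp [proj, projTuple_ι_mul, projStep]

@[simp] theorem proj_x2_mul (x : A) : proj k (ι k 1 * x) = projAfter k x := by
  simp [proj, projAfter, projTuple_ι_mul, projStep]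

@[simp] theorem proj_x3_mul (x : A) : proj k (ι k 2 * x) = ι k 2 * proj k x := by
  simp [proj, projTuple_ι_mul, projStep]

@[simp] theorem projAfter_x1_mul (x : A) : projAfter k (ι k 0 * x) = 0 := by
  simp [projAfter, projTuple_ι_mul, projStep]

@[simp] theorem projAfter_x2_mul (x : A) :
    projAfter k (ι k 1 * x) = ι k 1 * projAfter k x := by
  simp [projAfter, projTuple_ι_mul, projStep]

@[simp] theorem projAfter_x3_mul (x : A) : projAfter k (ι k 2 * x) = 0 := by
  simp [projAfter, projTuple_ι_mul, projStep]

theorem projAfter_x2_pow (j : ℕ) : projAfter k (ι k 1 ^ j) = ι k 1 ^ (j + 1) := by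
  induction j with
  | zero => simp
  | succ j ih => rw [pow_succ', projAfter_x2_mul, ih, ← pow_succ']

theorem proj_x2_pow (j : ℕ) : proj k (ι k 1 ^ j) = ι k 1 ^ j := by
  cases j with
  | zero => simp
  | succ j => rw [pow_succ', proj_x2_mul, projAfter_x2_pow, ← pow_succ']

theorem proj_x3_pow_mul_x2_pow (i j : ℕ) :
    proj k (ι k 2 ^ i * ι k 1 ^ j) = ι k 2 ^ i * ι k 1 ^ j := by
  induction i with
  | zero => simp [proj_x2_pow]
  | succ i ih => rw [pow_succ', mul_assoc, proj_x3_mul, ih]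

theorem proj_of_mem_normalSpan {n : ℕ} {x : A} (hx : x ∈ normalSpan k n) : proj k x = x := by
  have : normalSpan k n ≤ LinearMap.eqLocus (proj k) LinearMap.id := by
    rw [Submodule.span_le]
    rintro _ ⟨j, -, rfl⟩
    exact proj_x3_pow_mul_x2_pow _ _
  exact this hx

theorem x2_pow_mem_normalSpan (n : ℕ) : ι k 1 ^ n ∈ normalSpan k n :=
  Submodule.subset_span ⟨n, le_rfl, by simp⟩

theorem x3_mul_mem_normalSpan {n : ℕ} {x : A} (hx : x ∈ normalSpan k n) :
    ι k 2 * x ∈ normalSpan k (n + 1) := by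
  have : normalSpan k n ≤ (normalSpan k (n + 1)).comap (mulGen k 2) := by
    rw [Submodule.span_le]
    rintro _ ⟨j, hj, rfl⟩
    refine Submodule.subset_span ⟨j, by omega, ?_⟩
    simp [← mul_assoc, ← pow_succ', Nat.sub_add_comm hj]
  exact this hx

theorem ι_mem_Vgen (i : Fin 3) : ι k i ∈ Vgen k :=
  Submodule.subset_span (by fin_cases i <;> simp)

theorem normalSpan_le_Vgen_pow (n : ℕ) : normalSpan k n ≤ Vgen k ^ n := by
  rw [Submodule.span_le]
  rintro _ ⟨j, hj, rfl⟩
  have := Submodule.mul_mem_mul (Submodule.pow_mem_pow _ (ι_mem_Vgen (k := k) 2) (n - j))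
    (Submodule.pow_mem_pow _ (ι_mem_Vgen (k := k) 1) j)
  rwa [← pow_add, Nat.sub_add_cancel hj] at this

theorem Vgen_pow_le_comap (n : ℕ) :
    Vgen k ^ n ≤ (normalSpan k n).comap (proj k) ⊓
      (k ∙ (ι k 1 ^ (n + 1) : A)).comap (projAfter k) := by
  induction n with
  | zero =>
    rw [pow_zero, Submodule.one_le]
    refine ⟨?_, ?_⟩
    · simpa using x2_pow_mem_normalSpan (k := k) 0
    · simp
  | succ n ih =>
    rw [pow_succ', Submodule.mul_le]
    intro v hv x hx
    obtain ⟨h₁, h₂⟩ := ih hx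
    rw [SetLike.mem_coe, Submodule.mem_comap] at h₁ h₂
    have h₃ : projAfter k x ∈ normalSpan k (n + 1) :=
      (Submodule.span_singleton_le_iff_mem _ _).2 (x2_pow_mem_normalSpan _) h₂
    have h₄ : ι k 1 * projAfter k x ∈ (k ∙ (ι k 1 ^ (n + 1 + 1) : A)) := by
      obtain ⟨r, hr⟩ := Submodule.mem_span_singleton.1 h₂
      exact Submodule.mem_span_singleton.2 ⟨r, by rw [← hr, pow_succ' _ (n + 1), mul_smul_comm]⟩
    induction hv using Submodule.span_induction with
    | mem v hv =>
      rcases hv with rfl | rfl | rfl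
      · simp
      · simpa using ⟨h₃, h₄⟩
      · simpa using x3_mul_mem_normalSpan h₁
    | zero => simp
    | add v w _ _ hv hw => rw [add_mul]; exact Submodule.add_mem _ hv hw
    | smul r v _ hv => rw [smul_mul_assoc]; exact Submodule.smul_mem _ r hv

theorem proj_mem_normalSpan {n : ℕ} {x : A} (hx : x ∈ Vgen k ^ n) : proj k x ∈ normalSpan k n :=
  (Vgen_pow_le_comap n hx).1

end DGFree

namespace IsDGDifferential

open FreeAlgebra DGFree

variable {k : Type*} [Field k] {d : FreeAlgebra k (Fin 3) →ₗ[k] FreeAlgebra k (Fin 3)}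

theorem map_one (hd : IsDGDifferential k d) : d 1 = 0 := by
  simpa using hd.2.1 0 1 (by simp) 1

theorem map_ι_mul (hd : IsDGDifferential k d) (i : Fin 3) (x : FreeAlgebra k (Fin 3)) :
    d (ι k i * x) = d (ι k i) * x - ι k i * d x := by
  rw [hd.2.1 1 _ (by simpa using ι_mem_Vgen i), pow_one, neg_one_smul, sub_eq_add_neg]

theorem homotopy_identities (hd : IsDGDifferential k d)
    (hx1 : d (ι k 0) = ι k 1 * ι k 2) (hx2 : d (ι k 1) = 0) (hx3 : d (ι k 2) = 0)
    (x : FreeAlgebra k (Fin 3)) :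
    d (homotopy k x) + homotopy k (d x) = x - proj k x ∧
      d (homotopyAfter k x) - homotopyAfter k (d x) = ι k 1 * x - projAfter k x := by
  refine mem_of_one_mem_of_ι_mul_mem
    (LinearMap.eqLocus (d ∘ₗ homotopy k + homotopy k ∘ₗ d) (LinearMap.id - proj k) ⊓
      LinearMap.eqLocus (d ∘ₗ homotopyAfter k - homotopyAfter k ∘ₗ d)
        (mulGen k 1 - projAfter k)) ?_ ?_ x
  · simp [hd.map_one]
  · intro i x hx
    simp only [Submodule.mem_inf, LinearMap.mem_eqLocus, LinearMap.add_apply, LinearMap.sub_apply,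
      LinearMap.comp_apply, LinearMap.id_apply, LinearMap.mulLeft_apply] at hx ⊢
    obtain ⟨h₁, h₂⟩ := hx
    fin_cases i
    · simp [hd.map_ι_mul, hx1, mul_assoc]
    · simp only [Fin.mk_one, hd.map_ι_mul, hx2, zero_mul, zero_sub, map_neg, homotopy_x2_mul,
        homotopyAfter_x2_mul, proj_x2_mul, projAfter_x2_mul, neg_neg, ← sub_eq_add_neg,
        ← mul_sub, h₂, true_and]
    · have h₃ : ι k 2 * d (homotopy k x) + ι k 2 * homotopy k (d x) =
          ι k 2 * x - ι k 2 * proj k x := by rw [← mul_add, h₁, mul_sub]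
      simpa [hd.map_ι_mul, hx1, hx3, mul_assoc] using h₃

theorem map_proj (hd : IsDGDifferential k d) (hx2 : d (ι k 1) = 0) (hx3 : d (ι k 2) = 0)
    (x : FreeAlgebra k (Fin 3)) : d (proj k x) = 0 := by
  suffices h : x ∈ LinearMap.ker (d ∘ₗ proj k) ⊓ LinearMap.ker (d ∘ₗ projAfter k) from h.1
  refine mem_of_one_mem_of_ι_mul_mem _ (by simp [hd.map_one, hx2]) ?_ x
  rintro i y ⟨h₁, h₂⟩
  replace h₁ : d (proj k y) = 0 := h₁
  replace h₂ : d (projAfter k y) = 0 := h₂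
  fin_cases i <;> simp [hd.map_ι_mul, hx2, hx3, h₁, h₂]

end IsDGDifferential

/-- Suppose `d` is a differential on `A` with `d x1 = x2*x3`, `d x2 = 0` and
`d x3 = 0`. Then for every `n ≥ 0`:
`ker d ∩ A_n = (range d ∩ A_n) + span_k{x3^{n−j} * x2^j : 0 ≤ j ≤ n}` and
`span_k{x3^{n−j} * x2^j : 0 ≤ j ≤ n} ∩ range d = 0`.
(Equivalently, `H(A, d) ≅ k⟨⌈x2⌉,⌈x3⌉⟩/(⌈x2⌉·⌈x3⌉)`.) -/
theorem cohomology_of_dgfree_nonGorenstein (k : Type*) [Field k] [CharZero k]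
    (d : FreeAlgebra k (Fin 3) →ₗ[k] FreeAlgebra k (Fin 3))
    (hd : IsDGDifferential k d)
    (hx1 : d (FreeAlgebra.ι k 0) = FreeAlgebra.ι k 1 * FreeAlgebra.ι k 2)
    (hx2 : d (FreeAlgebra.ι k 1) = 0)
    (hx3 : d (FreeAlgebra.ι k 2) = 0) :
    (∀ n : ℕ,
      LinearMap.ker d ⊓ (Vgen k) ^ n =
        (LinearMap.range d ⊓ (Vgen k) ^ n) ⊔
          Submodule.span k
            {p : FreeAlgebra k (Fin 3) |
              ∃ j ≤ n, p = FreeAlgebra.ι k 2 ^ (n - j) * FreeAlgebra.ι k 1 ^ j}) ∧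
    (∀ n : ℕ,
      Submodule.span k
          {p : FreeAlgebra k (Fin 3) |
            ∃ j ≤ n, p = FreeAlgebra.ι k 2 ^ (n - j) * FreeAlgebra.ι k 1 ^ j} ⊓
        LinearMap.range d = ⊥) := by
  have key x := (hd.homotopy_identities hx1 hx2 hx3 x).1
  refine ⟨fun n => le_antisymm ?_ (sup_le ?_ (le_inf ?_ ?_)), fun n => ?_⟩
  · rintro x ⟨hx, hxn⟩
    have hp := DGFree.proj_mem_normalSpan hxn
    have hdx : d (DGFree.homotopy k x) = x - DGFree.proj k x := by
      simpa [LinearMap.mem_ker.1 hx] using key x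
    rw [← sub_add_cancel x (DGFree.proj k x)]
    exact Submodule.add_mem_sup ⟨⟨_, hdx⟩,
      Submodule.sub_mem _ hxn (DGFree.normalSpan_le_Vgen_pow n hp)⟩ hp
  · refine inf_le_inf_right _ ?_
    rintro _ ⟨y, rfl⟩
    exact hd.2.2 y
  · intro x hx
    rw [LinearMap.mem_ker, ← DGFree.proj_of_mem_normalSpan hx]
    exact hd.map_proj hx2 hx3 x
  · exact DGFree.normalSpan_le_Vgen_pow n
  · rw [eq_bot_iff]
    rintro _ ⟨hs, y, rfl⟩
    have hdy : d (DGFree.homotopy k (d y)) = 0 := by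
      simpa [hd.2.2, DGFree.proj_of_mem_normalSpan hs] using key (d y)
    simpa [hd.2.2, hdy, hd.map_proj hx2 hx3, eq_comm] using congrArg d (key y)
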